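/- Let Λ be a block and λ, μ, ν ∈ Λ such that underline λ ν overline μ is an oriented circle diagram, and let C be a circle of (underline λ)(overline μ). Let ν′ be the weight obtained from ν by reversing the label (∧ ↔ ∨) at every vertex of C and at no other vertex. Then underline λ ν′ overline μ is again an oriented circle diagram, and deg(underline λ ν′ overline μ) = deg(underline λ ν overline μ) + 2 if C was oriented anticlockwise in ν, and deg(underline λ ν′ overline μ) = deg(underline λ ν overline μ) − 2 if C was oriented clockwise in ν. -/

import Mathlib

namespace BK

/-- The symbols `∘, ×, ∨, ∧` labelling the integral positions of a weight. -/
inductive Symb : Type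
  | circ : Symb
  | times : Symb
  | dn : Symb
  | up : Symb
  deriving DecidableEq

/-- A (diagrammatical) weight: a sequence of symbols indexed by `ℤ`, equal to `∘`
for all but finitely many positions. -/
structure Weight : Type where
  lab : ℤ → Symb
  finite : {i : ℤ | lab i ≠ Symb.circ}.Finite

namespace Weight

/-- Two weights are equivalent (lie in the same block) if one is obtained from the
other by permuting the symbols `∧` and `∨`: the `∘`- and `×`-positions agree and the
number of `∧`'s agrees. -/
def Equiv (l m : Weight) : Prop :=
  (∀ i, l.lab i = Symb.circ ↔ m.lab i = Symb.circ) ∧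
  (∀ i, l.lab i = Symb.times ↔ m.lab i = Symb.times) ∧
  {i | l.lab i = Symb.up}.ncard = {i | m.lab i = Symb.up}.ncard

/-- The vertices of (the block of) a weight: the positions carrying `∧` or `∨`,
i.e. the positions where the block sequence has the symbol `★`. -/
def vertices (l : Weight) : Set ℤ :=
  {i | l.lab i = Symb.up ∨ l.lab i = Symb.dn}

/-- `up(Λ)`: the number of `∧`'s plus the number of `×`'s. -/
noncomputable def upNum (l : Weight) : ℕ :=
  {i | l.lab i = Symb.up}.ncard + {i | l.lab i = Symb.times}.ncard

/-- `down(Λ)`: the number of `∨`'s plus the number of `×`'s. -/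
noncomputable def downNum (l : Weight) : ℕ :=
  {i | l.lab i = Symb.dn}.ncard + {i | l.lab i = Symb.times}.ncard

/-- A block is balanced if `up(Λ) = down(Λ)`. -/
def Balanced (l : Weight) : Prop := l.upNum = l.downNum

end Weight

/-- A cup diagram (equally: the datum of a cap diagram, via the mirror image):
a set of cups `(i, j)` with `i < j` and a set of rays `i`. -/
@[ext]
structure CupDiagram : Type where
  cups : Set (ℤ × ℤ)
  rays : Set ℤ

namespace CupDiagram

/-- Compatibility of a cup diagram with the vertex set `V` of a block: endpoints lie in
`V` and are increasing, every vertex lies in exactly one arc, cups do not cross, and no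
ray lies under a cup. -/
def IsCompatible (c : CupDiagram) (V : Set ℤ) : Prop :=
  (∀ p ∈ c.cups, p.1 < p.2) ∧
  (∀ p ∈ c.cups, p.1 ∈ V ∧ p.2 ∈ V) ∧
  c.rays ⊆ V ∧
  (∀ v ∈ V, v ∈ c.rays ∨ ∃ p ∈ c.cups, v = p.1 ∨ v = p.2) ∧
  (∀ p ∈ c.cups, ∀ q ∈ c.cups,
    (p.1 = q.1 ∨ p.1 = q.2 ∨ p.2 = q.1 ∨ p.2 = q.2) → p = q) ∧
  (∀ p ∈ c.cups, p.1 ∉ c.rays ∧ p.2 ∉ c.rays) ∧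
  (∀ p ∈ c.cups, ∀ q ∈ c.cups, ¬(p.1 < q.1 ∧ q.1 < p.2 ∧ p.2 < q.2)) ∧
  (∀ p ∈ c.cups, ∀ k ∈ c.rays, ¬(p.1 < k ∧ k < p.2))

/-- The diagram `cλ` is oriented: every cup has exactly one endpoint `∨` and one `∧`,
every ray vertex is labeled `∨` or `∧`, and there are no rays `i < j` with
`λ_i = ∨` and `λ_j = ∧`. -/
def Oriented (c : CupDiagram) (l : Weight) : Prop :=
  (∀ p ∈ c.cups,
    (l.lab p.1 = Symb.dn ∧ l.lab p.2 = Symb.up) ∨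
    (l.lab p.1 = Symb.up ∧ l.lab p.2 = Symb.dn)) ∧
  (∀ k ∈ c.rays, l.lab k = Symb.up ∨ l.lab k = Symb.dn) ∧
  (∀ i ∈ c.rays, ∀ j ∈ c.rays, i < j → ¬(l.lab i = Symb.dn ∧ l.lab j = Symb.up))

/-- The degree of `cλ`: the number of clockwise cups (cups whose rightmost vertex is
labeled `∨`).  Applied to the mirror cap diagram this is the number of clockwise caps. -/
noncomputable def deg (c : CupDiagram) (l : Weight) : ℕ :=
  {p ∈ c.cups | l.lab p.2 = Symb.dn}.ncard

end CupDiagram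

/-- `c` is the cup diagram `underline l` of the weight `l`: it is compatible with the
block of `l`, the diagram `c l` is oriented, and `deg (c l) = 0`. -/
def IsLowerDiagram (c : CupDiagram) (l : Weight) : Prop :=
  c.IsCompatible l.vertices ∧ c.Oriented l ∧ c.deg l = 0

/-- Adjacency of vertices in the circle diagram `c d*`: two vertices are adjacent when
they are joined by a cup of `c` or a cap of `d*`. -/
def adjArc (c d : CupDiagram) (v w : ℤ) : Prop :=
  (v, w) ∈ c.cups ∨ (w, v) ∈ c.cups ∨ (v, w) ∈ d.cups ∨ (w, v) ∈ d.cups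

/-- `S` is a connected component of the circle diagram `c d*`. -/
def IsComponent (c d : CupDiagram) (S : Set ℤ) : Prop :=
  ∃ v ∈ S, S = {w | Relation.ReflTransGen (adjArc c d) v w}

/-- `S` is a circle of the circle diagram `c d*`: a connected component containing
no ray. -/
def IsCircle (c d : CupDiagram) (S : Set ℤ) : Prop :=
  IsComponent c d S ∧ ∀ v ∈ S, v ∉ c.rays ∧ v ∉ d.rays

/-- The degree of the oriented circle diagram `c n d*`: the number of clockwise cups
of `c n` plus the number of clockwise caps of `n d*`. -/
noncomputable def degCirc (c d : CupDiagram) (n : Weight) : ℕ :=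
  {p ∈ c.cups | n.lab p.2 = Symb.dn}.ncard + {p ∈ d.cups | n.lab p.2 = Symb.dn}.ncard

/-- The position `p_Λ(i)` of `i` in the block of `l`. -/
noncomputable def posn (l : Weight) (i : ℤ) : ℕ :=
  {j | j ≤ i ∧ (l.lab j = Symb.up ∨ l.lab j = Symb.dn)}.ncard +
    2 * {j | j ≤ i ∧ l.lab j = Symb.times}.ncard

/-- The distance `d_Λ(γ) = |p_Λ(i) − p_Λ(j)|` of an arc `γ = {i, j}`. -/
noncomputable def arcDist (l : Weight) (i j : ℤ) : ℕ := ((posn l i : ℤ) - (posn l j : ℤ)).natAbs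


/-- The label flip `∧ ↔ ∨`. -/
def Symb.flip : Symb → Symb
  | Symb.up => Symb.dn
  | Symb.dn => Symb.up
  | s => s

/-- `f` restricts to a fixed-point-free noncrossing involution of the finite set `S`. -/
structure IsNoncrossingMatching (S : Finset ℤ) (f : ℤ → ℤ) : Prop where
  mem : ∀ v ∈ S, f v ∈ S
  invol : ∀ v ∈ S, f (f v) = v
  ne : ∀ v ∈ S, f v ≠ v
  noncross : ∀ v ∈ S, ∀ w ∈ S, ¬(v < w ∧ w < f v ∧ f v < f w)

/-- The sum over `v ∈ S` of `ε v`, counted positively if `v` is the right endpoint of its arc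
`{v, f v}` and negatively if it is the left endpoint. -/
def arcSum (S : Finset ℤ) (f ε : ℤ → ℤ) : ℤ :=
  ∑ v ∈ S, if f v < v then ε v else -ε v

/-- The matching obtained from `f` by deleting `i` and `j` and joining `f i` to `f j`. -/
def contract (f : ℤ → ℤ) (i j v : ℤ) : ℤ :=
  if v = f i then f j else if v = f j then f i else f v

/-- A point under an arc has its partner under the same arc. -/
lemma IsNoncrossingMatching.between {S : Finset ℤ} {f : ℤ → ℤ}
    (hf : IsNoncrossingMatching S f) {v w : ℤ} (hv : v ∈ S) (hw : w ∈ S)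
    (h : v < w ∧ w < f v) : v < f w ∧ f w < f v := by
  have h₁ := hf.noncross v hv w hw
  have h₂ := hf.noncross (f w) (hf.mem w hw) v hv
  have hvv := hf.invol v hv
  have hww := hf.invol w hw
  rw [hww] at h₂
  have h₃ : f w ≠ v := fun h' => by rw [← h', hww] at h; omega
  have h₄ : f w ≠ f v := fun h' => by rw [h', hvv] at hww; omega
  omega

/-- The relative position of the arcs at two adjacent points `i < j` not joined to each other. -/
lemma IsNoncrossingMatching.arcs_of_adjacent {S : Finset ℤ} {f : ℤ → ℤ}
    (hf : IsNoncrossingMatching S f) {i j : ℤ} (hi : i ∈ S) (hj : j ∈ S) (hij : i < j)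
    (hadj : ∀ w ∈ S, ¬(i < w ∧ w < j)) (hne : f i ≠ j) :
    f i < i ∧ j < f j ∨ j < f j ∧ f j < f i ∨ f j < f i ∧ f i < i := by
  have hii := hf.invol i hi
  have hjj := hf.invol j hj
  have hni := hf.ne i hi
  have hnj := hf.ne j hj
  have hai := hadj _ (hf.mem i hi)
  have haj := hadj _ (hf.mem j hj)
  have b1 := hf.between hi hj
  have b2 := hf.between (hf.mem j hj) hi
  rw [hjj] at b2
  rcases lt_or_gt_of_ne hni with h | h
  · rcases lt_or_gt_of_ne hnj with h' | h'
    · have : f j ≠ i := fun h => hne (by rw [← h, hjj])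
      omega
    · omega
  · omega

/-- A noncrossing matching with an arc avoiding the maximum `t` has an innermost arc avoiding `t`. -/
lemma IsNoncrossingMatching.exists_innermost {S : Finset ℤ} {f : ℤ → ℤ}
    (hf : IsNoncrossingMatching S f) {t : ℤ} (htmax : ∀ v ∈ S, v ≤ t)
    {u : ℤ} (hu : u ∈ S) (hut : u ≠ t) (hft : f u ≠ t) :
    ∃ i ∈ S, i < f i ∧ f i ≠ t ∧ ∀ w ∈ S, ¬(i < w ∧ w < f i) := by
  classical
  have hne : (S.filter fun i => i < f i ∧ f i ≠ t).Nonempty := by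
    rcases lt_or_gt_of_ne (hf.ne u hu) with h | h
    · exact ⟨f u, by simp [hf.mem u hu, hf.invol u hu, h, hut]⟩
    · exact ⟨u, by simp [hu, h, hft]⟩
  obtain ⟨i, hi, hmin⟩ := Finset.exists_min_image _ (fun i => f i - i) hne
  simp only [Finset.mem_filter] at hi hmin
  refine ⟨i, hi.1, hi.2.1, hi.2.2, fun w hw hiw => ?_⟩
  have hbet := hf.between hi.1 hw hiw
  have hit := htmax _ (hf.mem i hi.1)
  have hwinv := hf.invol w hw
  rcases lt_or_gt_of_ne (hf.ne w hw) with h | h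
  · have := hmin (f w) ⟨hf.mem w hw, by omega, by omega⟩
    rw [hwinv] at this
    omega
  · have := hmin w ⟨hw, h, by omega⟩
    omega

/-- Contracting two adjacent points not joined to each other keeps a matching noncrossing. -/
lemma IsNoncrossingMatching.contract {S : Finset ℤ} {f : ℤ → ℤ}
    (hf : IsNoncrossingMatching S f) {i j : ℤ} (hi : i ∈ S) (hj : j ∈ S) (hij : i < j)
    (hadj : ∀ w ∈ S, ¬(i < w ∧ w < j)) (hne : f i ≠ j) :
    IsNoncrossingMatching (S \ {i, j}) (contract f i j) := by
  have hfi := hf.mem i hi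
  have hfj := hf.mem j hj
  have hii := hf.invol i hi
  have hjj := hf.invol j hj
  have hni := hf.ne i hi
  have hnj := hf.ne j hj
  have hne' : f j ≠ i := fun h => hne (by rw [← h, hjj])
  have hxy : f i ≠ f j := fun h => by rw [← hii, h, hjj] at hij; omega
  have harcs := hf.arcs_of_adjacent hi hj hij hadj hne
  have hmem : ∀ v ∈ S, v ≠ i → v ≠ j → v ≠ f i → v ≠ f j →
      f v ∈ S ∧ f v ≠ i ∧ f v ≠ j ∧ f v ≠ f i ∧ f v ≠ f j ∧ f (f v) = v := by
    intro v hv h1 h2 h3 h4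
    have hvv := hf.invol v hv
    refine ⟨hf.mem v hv, ?_, ?_, ?_, ?_, hvv⟩ <;> intro h <;> rw [h] at hvv <;> omega
  -- the arcs at `i` and `j`, contrasted with each other and with any other arc
  have key : ∀ v ∈ S, v ≠ i → v ≠ j → v ≠ f i → v ≠ f j →
      ¬(f i < v ∧ v < f j ∧ f j < f v) ∧ ¬(f j < v ∧ v < f i ∧ f i < f v) ∧
      ¬(v < f i ∧ f i < f v ∧ f v < f j) ∧ ¬(v < f j ∧ f j < f v ∧ f v < f i) := by
    intro v hv h1 h2 h3 h4
    obtain ⟨m1, m2, m3, m4, m5, m6⟩ := hmem v hv h1 h2 h3 h4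
    have a1 := hadj v hv
    have a2 := hadj _ m1
    have b1 := hf.between hi hv
    have b2 := hf.between hfi hv
    have b3 := hf.between hj hv
    have b4 := hf.between hfj hv
    have d1 := hf.between hi m1
    have d2 := hf.between hfi m1
    have d3 := hf.between hj m1
    have d4 := hf.between hfj m1
    rw [hii] at b2 d2
    rw [hjj] at b4 d4
    rw [m6] at d1 d2 d3 d4
    rcases harcs with h | h | h
    · clear b1 b4 d1 d4
      refine ⟨?_, ?_, ?_, ?_⟩ <;> omega
    · clear b2 b4 d2 d4
      refine ⟨?_, ?_, ?_, ?_⟩ <;> omega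
    · clear b1 b3 d1 d3
      refine ⟨?_, ?_, ?_, ?_⟩ <;> omega
  constructor
  · intro v hv
    simp only [Finset.mem_sdiff, Finset.mem_insert, Finset.mem_singleton, not_or] at hv ⊢
    unfold BK.contract
    split_ifs with h1 h2
    · exact ⟨hfj, hne', hnj⟩
    · exact ⟨hfi, hni, hne⟩
    · have := hmem v hv.1 hv.2.1 hv.2.2 h1 h2
      tauto
  · intro v hv
    simp only [Finset.mem_sdiff, Finset.mem_insert, Finset.mem_singleton, not_or] at hv
    unfold BK.contract
    by_cases h1 : v = f i
    · simp [h1, hxy.symm]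
    by_cases h2 : v = f j
    · simp [h2, hxy.symm]
    have := hmem v hv.1 hv.2.1 hv.2.2 h1 h2
    simp [h1, h2, this]
  · intro v hv
    simp only [Finset.mem_sdiff, Finset.mem_insert, Finset.mem_singleton, not_or] at hv
    unfold BK.contract
    split_ifs with h1 h2
    · exact fun h => hxy (by rw [← h1, h])
    · exact fun h => hxy (by rw [← h2, h])
    · exact hf.ne v hv.1
  · intro v hv w hw
    simp only [Finset.mem_sdiff, Finset.mem_insert, Finset.mem_singleton, not_or] at hv hw
    unfold BK.contract
    by_cases h1 : v = f i
    · by_cases h3 : w = f i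
      · omega
      by_cases h4 : w = f j
      · simp only [h1, h4, hxy.symm, if_true, if_false]; omega
      have := key w hw.1 hw.2.1 hw.2.2 h3 h4
      simp only [h1, h3, h4, if_true, if_false]; omega
    by_cases h2 : v = f j
    · by_cases h3 : w = f i
      · simp only [h2, h3, hxy.symm, if_true, if_false]; omega
      by_cases h4 : w = f j
      · omega
      have := key w hw.1 hw.2.1 hw.2.2 h3 h4
      simp only [h2, h3, h4, hxy.symm, if_true, if_false]; omega
    have := key v hv.1 hv.2.1 hv.2.2 h1 h2
    by_cases h3 : w = f i
    · simp only [h1, h2, h3, if_true, if_false]; omega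
    by_cases h4 : w = f j
    · simp only [h1, h2, h4, hxy.symm, if_true, if_false]; omega
    simp only [h1, h2, h3, h4, if_false]
    exact hf.noncross v hv.1 w hw.1

/-- Contracting adjacent points `i < j` with opposite labels changes the arc sum by `2 ε j`. -/
lemma IsNoncrossingMatching.arcSum_contract {S : Finset ℤ} {f ε : ℤ → ℤ}
    (hf : IsNoncrossingMatching S f) (hε : ∀ v ∈ S, ε (f v) = -ε v)
    {i j : ℤ} (hi : i ∈ S) (hj : j ∈ S) (hij : i < j)
    (hadj : ∀ w ∈ S, ¬(i < w ∧ w < j)) (hne : f i ≠ j) (hεij : ε j = -ε i) :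
    arcSum S f ε = arcSum (S \ {i, j}) (BK.contract f i j) ε - 2 * ε j := by
  have hfi := hf.mem i hi
  have hfj := hf.mem j hj
  have hii := hf.invol i hi
  have hjj := hf.invol j hj
  have hni := hf.ne i hi
  have hnj := hf.ne j hj
  have hne' : f j ≠ i := fun h => hne (by rw [← h, hjj])
  have hxy : f i ≠ f j := fun h => by rw [← hii, h, hjj] at hij; omega
  have harcs := hf.arcs_of_adjacent hi hj hij hadj hne
  have ei := hε i hi
  have ej := hε j hj
  have hsub : ({i, j} : Finset ℤ) ⊆ S := by
    simp [Finset.insert_subset_iff, hi, hj]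
  have hsub' : ({f i, f j} : Finset ℤ) ⊆ S \ {i, j} := by
    simp [Finset.insert_subset_iff, hfi, hfj, hni, hnj, hne, hne']
  unfold arcSum
  rw [← Finset.sum_sdiff hsub, ← Finset.sum_sdiff hsub', ← Finset.sum_sdiff hsub',
    Finset.sum_pair hij.ne, Finset.sum_pair hxy, Finset.sum_pair hxy]
  have hrest : ∑ v ∈ (S \ {i, j}) \ {f i, f j}, (if BK.contract f i j v < v then ε v else -ε v)
      = ∑ v ∈ (S \ {i, j}) \ {f i, f j}, (if f v < v then ε v else -ε v) := by
    refine Finset.sum_congr rfl fun v hv => ?_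
    simp only [Finset.mem_sdiff, Finset.mem_insert, Finset.mem_singleton, not_or] at hv
    simp [BK.contract, hv.2.1, hv.2.2]
  rw [hrest]
  simp only [BK.contract, hii, hjj, hxy.symm, if_true, if_false, ei, ej, hεij]
  rcases harcs with h | h | h <;> split_ifs <;> omega

/-- The combinatorial turning number of a closed meander: if two noncrossing matchings of `S`
form a single closed curve with an alternating labelling `ε`, then the total turning is
determined by the label of the rightmost point. -/
theorem arcSum_add_arcSum {S : Finset ℤ} {f g ε : ℤ → ℤ} {t : ℤ}
    (hf : IsNoncrossingMatching S f) (hg : IsNoncrossingMatching S g)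
    (hfε : ∀ v ∈ S, ε (f v) = -ε v) (hgε : ∀ v ∈ S, ε (g v) = -ε v)
    (ht : t ∈ S) (htmax : ∀ v ∈ S, v ≤ t)
    (hconn : ∀ T ⊆ S, T.Nonempty → (∀ v ∈ T, f v ∈ T ∧ g v ∈ T) → T = S) :
    arcSum S f ε + arcSum S g ε = 4 * ε t := by
  induction hk : S.card using Nat.strong_induction_on generalizing S g with
  | _ k ih =>
  have hft : f t < t := lt_of_le_of_ne (htmax _ (hf.mem t ht)) (hf.ne t ht)
  have hgt : g t < t := lt_of_le_of_ne (htmax _ (hg.mem t ht)) (hg.ne t ht)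
  by_cases hex : ∃ u ∈ S, u ≠ t ∧ f u ≠ t
  · obtain ⟨u, hu, hut, hfut⟩ := hex
    obtain ⟨i, hi, hij, hjt, hadj⟩ := hf.exists_innermost htmax hu hut hfut
    obtain ⟨j, hj⟩ : ∃ j, j = f i := ⟨_, rfl⟩
    rw [← hj] at hij hjt hadj
    have hjS : j ∈ S := hj ▸ hf.mem i hi
    have hfj : f j = i := by rw [hj, hf.invol i hi]
    have hεij : ε j = -ε i := hj ▸ hfε i hi
    have hit : i ≠ t := by have := htmax j hjS; omega
    have hgi := hg.mem i hi
    have hgj := hg.mem j hjS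
    have hgii := hg.invol i hi
    have hgjj := hg.invol j hjS
    have hgij : g i ≠ j := by
      intro h
      have := hconn {i, j} (by simp [Finset.insert_subset_iff, hi, hjS]) (by simp)
        (by simp [← hj, hfj, h, show g j = i by rw [← h, hgii]])
      rw [← this] at ht
      simp only [Finset.mem_insert, Finset.mem_singleton] at ht
      omega
    have hfS' : IsNoncrossingMatching (S \ {i, j}) f := by
      refine ⟨fun v hv => ?_, fun v hv => ?_, fun v hv => ?_, fun v hv w hw => ?_⟩ <;>
        simp only [Finset.mem_sdiff, Finset.mem_insert, Finset.mem_singleton, not_or] at *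
      · have := hf.invol v hv.1
        refine ⟨hf.mem v hv.1, fun h => ?_, fun h => ?_⟩ <;> rw [h] at this <;> omega
      · exact hf.invol v hv.1
      · exact hf.ne v hv.1
      · exact hf.noncross v hv.1 w hw.1
    have hsumf : arcSum S f ε = arcSum (S \ {i, j}) f ε + 2 * ε j := by
      unfold arcSum
      rw [← Finset.sum_sdiff (show ({i, j} : Finset ℤ) ⊆ S by
        simp [Finset.insert_subset_iff, hi, hjS]), Finset.sum_pair hij.ne, ← hj, hfj]
      split_ifs <;> omega
    have hsumg := hg.arcSum_contract hgε hi hjS hij hadj hgij hεij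
    have hrec := ih (S \ {i, j}).card
      (hk ▸ Finset.card_lt_card (Finset.sdiff_ssubset
        (by simp [Finset.insert_subset_iff, hi, hjS]) (by simp)))
      hfS' (hg.contract hi hjS hij hadj hgij)
      (fun v hv => hfε v (Finset.sdiff_subset hv))
      (fun v hv => ?_) (by simp [ht, hit.symm, Ne.symm hjt])
      (fun v hv => htmax v (Finset.sdiff_subset hv)) (fun T hT hTne hTc => ?_) rfl
    · omega
    · have h1 := hgε i hi
      have h2 := hgε j hjS
      have h3 := hgε v (Finset.sdiff_subset hv)
      unfold contract
      split_ifs with h h'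
      · rw [h, h1, h2, hεij]
      · rw [h', h1, h2, hεij]
        omega
      · exact h3
    · have hTS : ∀ v ∈ T, v ∈ S ∧ v ≠ i ∧ v ≠ j := fun v hv => by simpa using hT hv
      by_cases hx : g i ∈ T ∨ g j ∈ T
      · have hx' : g i ∈ T ∧ g j ∈ T := by
          rcases hx with hx | hx
          · exact ⟨hx, by simpa [contract] using (hTc _ hx).2⟩
          · refine ⟨?_, hx⟩
            have := (hTc _ hx).2
            unfold contract at this
            split_ifs at this with h
            · exact h ▸ hx
            · exact this
            · contradiction
        have hU := hconn (T ∪ {i, j})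
          (Finset.union_subset (hT.trans Finset.sdiff_subset)
            (by simp [Finset.insert_subset_iff, hi, hjS])) (by simp) (fun v hv => ?_)
        · ext v
          have := hTS v
          simp only [← hU, Finset.mem_sdiff, Finset.mem_union, Finset.mem_insert,
            Finset.mem_singleton]
          tauto
        · simp only [Finset.mem_union, Finset.mem_insert, Finset.mem_singleton] at hv ⊢
          rcases hv with hv | rfl | rfl
          · refine ⟨Or.inl (hTc v hv).1, ?_⟩
            by_cases h1 : v = g i
            · simp [h1, hgii]
            by_cases h2 : v = g j
            · simp [h2, hgjj]
            have := (hTc v hv).2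
            simp only [contract, h1, h2, if_false] at this
            exact Or.inl this
          · simp [← hj, hx'.1]
          · simp [hfj, hx'.2]
      · push Not at hx
        have hU := hconn T (hT.trans Finset.sdiff_subset) hTne fun v hv => by
          have := (hTc v hv).2
          simp only [contract, show v ≠ g i from fun h => hx.1 (h ▸ hv),
            show v ≠ g j from fun h => hx.2 (h ▸ hv), if_false] at this
          exact ⟨(hTc v hv).1, this⟩
        exact absurd rfl (hTS i (hU ▸ hi)).2.1
  · push Not at hex
    have hS : S = {t, f t} := by
      ext v
      simp only [Finset.mem_insert, Finset.mem_singleton]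
      constructor
      · intro hv
        by_cases h : v = t
        · exact Or.inl h
        · exact Or.inr (by rw [← hex v hv h, hf.invol v hv])
      · rintro (rfl | rfl)
        exacts [ht, hf.mem _ ht]
    have hgf : g t = f t := by
      have := hg.mem t ht
      rw [hS] at this
      simp only [Finset.mem_insert, Finset.mem_singleton] at this
      omega
    have h1 := hf.invol t ht
    have h2 := hg.invol t ht
    have h3 := hfε t ht
    rw [hgf] at h2
    unfold arcSum
    rw [hS, Finset.sum_pair hft.ne', Finset.sum_pair hft.ne', hgf, h1, h2, h3]
    split_ifs <;> omega

/-- The arc sum is twice the signed number of right endpoints. -/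
lemma IsNoncrossingMatching.arcSum_eq {S : Finset ℤ} {f ε : ℤ → ℤ}
    (hf : IsNoncrossingMatching S f) (hε : ∀ v ∈ S, ε (f v) = -ε v) :
    arcSum S f ε = 2 * ∑ v ∈ S with f v < v, ε v := by
  have h : ∑ v ∈ S with ¬ f v < v, -ε v = ∑ v ∈ S with f v < v, ε v := by
    refine Finset.sum_nbij' f f ?_ ?_ ?_ ?_ ?_ <;> intro v hv <;>
      simp only [Finset.mem_filter] at hv ⊢
    · have := hf.ne v hv.1
      exact ⟨hf.mem v hv.1, by rw [hf.invol v hv.1]; omega⟩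
    · exact ⟨hf.mem v hv.1, by rw [hf.invol v hv.1]; omega⟩
    · exact hf.invol v hv.1
    · exact hf.invol v hv.1
    · exact (hε v hv.1).symm
  unfold arcSum
  rw [Finset.sum_ite, h, two_mul]

/-- A vertex is joined by cups to at most one other vertex. -/
lemma CupDiagram.IsCompatible.eq_of_joined {c : CupDiagram} {V : Set ℤ} (hc : c.IsCompatible V)
    {v w x : ℤ} (hw : (v, w) ∈ c.cups ∨ (w, v) ∈ c.cups)
    (hx : (v, x) ∈ c.cups ∨ (x, v) ∈ c.cups) : w = x := by
  rcases hw with h | h <;> rcases hx with h' | h' <;>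
    have := hc.2.2.2.2.1 _ h _ h' (by simp) <;> simp only [Prod.mk.injEq] at this <;> omega

/-- A finite ray-free union of cups is the graph of a noncrossing matching. -/
lemma CupDiagram.IsCompatible.exists_matching {c : CupDiagram} {V : Set ℤ}
    (hc : c.IsCompatible V) {S : Finset ℤ} (hSV : ∀ v ∈ S, v ∈ V) (hray : ∀ v ∈ S, v ∉ c.rays)
    (hcl : ∀ p ∈ c.cups, p.1 ∈ S ↔ p.2 ∈ S) :
    ∃ f, IsNoncrossingMatching S f ∧ ∀ v ∈ S, (v, f v) ∈ c.cups ∨ (f v, v) ∈ c.cups := by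
  obtain ⟨hlt, -, -, hcover, -, -, hcross, -⟩ := id hc
  have hex : ∀ v, ∃ w, v ∈ S → (v, w) ∈ c.cups ∨ (w, v) ∈ c.cups := by
    intro v
    by_cases hv : v ∈ S
    · rcases hcover v (hSV v hv) with h | ⟨⟨x, y⟩, hp, rfl | rfl⟩
      · exact absurd h (hray v hv)
      · exact ⟨y, fun _ => Or.inl hp⟩
      · exact ⟨x, fun _ => Or.inr hp⟩
    · exact ⟨0, fun h => absurd h hv⟩
  choose f hf using hex
  have hmem : ∀ v ∈ S, f v ∈ S := fun v hv => by
    rcases hf v hv with h | h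
    · exact (hcl _ h).1 hv
    · exact (hcl _ h).2 hv
  refine ⟨f, ⟨hmem, fun v hv => ?_, fun v hv => ?_, fun v hv w hw hvw => ?_⟩, hf⟩
  · exact hc.eq_of_joined (hf _ (hmem v hv)) (hf v hv).symm
  · rcases hf v hv with h | h
    · exact (hlt _ h).ne'
    · exact (hlt _ h).ne
  · have hv' : (v, f v) ∈ c.cups := (hf v hv).resolve_right fun h => by
      have := hlt _ h
      simp only at this
      omega
    have hw' : (w, f w) ∈ c.cups := (hf w hw).resolve_right fun h => by
      have := hlt _ h
      simp only at this
      omega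
    exact hcross _ hv' _ hw' hvw

/-- The labelling of a weight by signs, `∧ ↦ 1` and `∨ ↦ -1`. -/
def Weight.sgn (n : Weight) (v : ℤ) : ℤ := if n.lab v = Symb.up then 1 else -1

lemma CupDiagram.Oriented.sgn_eq_neg {c : CupDiagram} {n : Weight} (h : c.Oriented n)
    {v w : ℤ} (hvw : (v, w) ∈ c.cups ∨ (w, v) ∈ c.cups) : n.sgn w = -n.sgn v := by
  unfold Weight.sgn
  rcases hvw with hp | hp <;> rcases h.1 _ hp with ⟨h1, h2⟩ | ⟨h1, h2⟩ <;>
    simp only at h1 h2 <;> simp [h1, h2]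

open scoped Classical in
lemma CupDiagram.Oriented.reverse {c : CupDiagram} {n n' : Weight} (h : c.Oriented n) {S : Set ℤ}
    (hray : ∀ v ∈ S, v ∉ c.rays) (hcl : ∀ p ∈ c.cups, p.1 ∈ S ↔ p.2 ∈ S)
    (hn' : ∀ i, n'.lab i = if i ∈ S then (n.lab i).flip else n.lab i) : c.Oriented n' := by
  have hr : ∀ k ∈ c.rays, n'.lab k = n.lab k := fun k hk => by
    rw [hn', if_neg fun hkS => hray k hkS hk]
  refine ⟨fun p hp => ?_, fun k hk => hr k hk ▸ h.2.1 k hk, fun i hi j hj => ?_⟩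
  · have := hcl p hp
    rw [hn', hn']
    by_cases hS : p.1 ∈ S
    · rw [if_pos hS, if_pos (this.1 hS)]
      rcases h.1 p hp with ⟨h1, h2⟩ | ⟨h1, h2⟩ <;> simp [h1, h2, Symb.flip]
    · rw [if_neg hS, if_neg (mt this.2 hS)]
      exact h.1 p hp
  · rw [hr i hi, hr j hj]
    exact h.2.2 i hi j hj

lemma CupDiagram.IsCompatible.finite_cups {c : CupDiagram} {V : Set ℤ} (hc : c.IsCompatible V)
    (hV : V.Finite) : c.cups.Finite :=
  (hV.prod hV).subset fun p hp => hc.2.1 p hp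

open scoped Classical in
/-- The change of the number of clockwise cups under reversal of the labels on `S`. -/
lemma CupDiagram.IsCompatible.deg_reverse {c : CupDiagram} {V : Set ℤ} (hc : c.IsCompatible V)
    (hV : V.Finite) {n n' : Weight} (h : c.Oriented n) {S : Finset ℤ} {f : ℤ → ℤ}
    (hf : IsNoncrossingMatching S f)
    (hfc : ∀ v ∈ S, (v, f v) ∈ c.cups ∨ (f v, v) ∈ c.cups)
    (hn' : ∀ i, n'.lab i = if i ∈ S then (n.lab i).flip else n.lab i) :
    2 * ((c.deg n' : ℤ) - c.deg n) = arcSum S f n.sgn := by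
  rw [hf.arcSum_eq fun v hv => h.sgn_eq_neg (hfc v hv)]
  congr 1
  have hfin := hc.finite_cups hV
  set A := hfin.toFinset with hA
  have hcard : ∀ k : Weight, (c.deg k : ℤ) = ∑ p ∈ A, if k.lab p.2 = Symb.dn then 1 else 0 := by
    intro k
    rw [Finset.sum_boole, CupDiagram.deg, ← Set.ncard_coe_finset]
    congr 2
    ext p
    simp [hA]
  have himg : (S.filter fun v => f v < v) = (A.filter fun p => p.2 ∈ S).image Prod.snd := by
    ext v
    simp only [Finset.mem_filter, Finset.mem_image, hA, Set.Finite.mem_toFinset]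
    constructor
    · rintro ⟨hv, hlt⟩
      refine ⟨(f v, v), ⟨(hfc v hv).resolve_left fun hp => ?_, hv⟩, rfl⟩
      have := hc.1 _ hp
      simp only at this
      omega
    · rintro ⟨⟨x, y⟩, ⟨hp, hv⟩, rfl⟩
      refine ⟨hv, ?_⟩
      simp only at hv ⊢
      have hlt := hc.1 _ hp
      rcases hfc y hv with hq | hq <;> have heq := hc.2.2.2.2.1 _ hp _ hq (by simp)
      · simp only [Prod.mk.injEq] at heq hlt
        omega
      · simp only [Prod.mk.injEq] at heq hlt
        omega
  rw [hcard, hcard, ← Finset.sum_sub_distrib, himg, Finset.sum_image, Finset.sum_filter]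
  · refine Finset.sum_congr rfl fun p hp => ?_
    rw [hn']
    rcases h.1 p (by simpa [hA] using hp) with ⟨-, h2⟩ | ⟨-, h2⟩ <;>
      by_cases hS : p.2 ∈ S <;> simp [h2, hS, Symb.flip, Weight.sgn]
  · intro p hp q hq hpq
    simp only [Finset.coe_filter, hA, Set.Finite.mem_toFinset, Set.mem_ofPred_eq] at hp hq
    exact hc.2.2.2.2.1 p hp.1 q hq.1 (by simp [hpq])

lemma Weight.finite_vertices (l : Weight) : l.vertices.Finite :=
  l.finite.subset fun i hi => by rcases hi with h | h <;> simp [h]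

lemma Weight.Equiv.vertices_eq {l m : Weight} (h : l.Equiv m) : l.vertices = m.vertices := by
  ext i
  have h1 := h.1 i
  have h2 := h.2.1 i
  simp only [Weight.vertices, Set.mem_ofPred_eq]
  cases hl : l.lab i <;> cases hm : m.lab i <;> simp_all

lemma adjArc.symm {c d : CupDiagram} {v w : ℤ} (h : adjArc c d v w) : adjArc c d w v := by
  unfold adjArc at *
  tauto

lemma IsComponent.mem_iff {c d : CupDiagram} {S : Set ℤ} (hS : IsComponent c d S) {v w : ℤ}
    (h : adjArc c d v w) : v ∈ S ↔ w ∈ S := by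
  obtain ⟨u, -, rfl⟩ := hS
  exact ⟨fun hv => hv.tail h, fun hw => hw.tail h.symm⟩

/-- A component has no proper nonempty subset closed under adjacency. -/
lemma IsComponent.subset_of_closed {c d : CupDiagram} {S T : Set ℤ} (hS : IsComponent c d S)
    (hTS : T ⊆ S) (hT : T.Nonempty) (hcl : ∀ v ∈ T, ∀ w, adjArc c d v w → w ∈ T) : S ⊆ T := by
  have hreach : ∀ v ∈ T, ∀ w, Relation.ReflTransGen (adjArc c d) v w → w ∈ T := by
    intro v hv w hw
    induction hw with
    | refl => exact hv
    | tail _ h ih => exact hcl _ ih _ h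
  obtain ⟨x, hx⟩ := hT
  obtain ⟨u, -, rfl⟩ := hS
  have hux : Relation.ReflTransGen (adjArc c d) u x := hTS hx
  have hu := hreach x hx u (have : Std.Symm (adjArc c d) := ⟨fun _ _ h => h.symm⟩; Std.Symm.symm _ _ hux)
  exact fun w hw => hreach u hu w hw

open scoped Classical in
/-- Reversing the orientation of one circle: if `ν′` is obtained from `ν` by
reversing the label at every vertex of a circle `C` of `(underline λ)(overline μ)`
(and nowhere else), then `underline λ ν′ overline μ` is again oriented and its
degree increases by `2` if `C` was anticlockwise and decreases by `2` if `C` was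
clockwise. -/
theorem circle_reorientation_degree (l m n n' : Weight)
    (hlm : l.Equiv m) (hln : l.Equiv n)
    (c d : CupDiagram)
    (hc : IsLowerDiagram c l) (hd : IsLowerDiagram d m)
    (hcn : c.Oriented n) (hdn : d.Oriented n)
    (S : Set ℤ) (hS : IsCircle c d S)
    (hn' : ∀ i, n'.lab i = if i ∈ S then (n.lab i).flip else n.lab i)
    (t : ℤ) (ht : t ∈ S) (htmax : ∀ v ∈ S, v ≤ t) :
    c.Oriented n' ∧ d.Oriented n' ∧
    (n.lab t = Symb.up → degCirc c d n' = degCirc c d n + 2) ∧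
    (n.lab t = Symb.dn → degCirc c d n' + 2 = degCirc c d n) := by
  have hclc : ∀ p ∈ c.cups, p.1 ∈ S ↔ p.2 ∈ S := fun p hp => hS.1.mem_iff (Or.inl hp)
  have hcld : ∀ p ∈ d.cups, p.1 ∈ S ↔ p.2 ∈ S :=
    fun p hp => hS.1.mem_iff (Or.inr (Or.inr (Or.inl hp)))
  have hrayc : ∀ v ∈ S, v ∉ c.rays := fun v hv => (hS.2 v hv).1
  have hrayd : ∀ v ∈ S, v ∉ d.rays := fun v hv => (hS.2 v hv).2
  have hcc := hc.1
  have hdc := hd.1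
  rw [← hlm.vertices_eq] at hdc
  have main : t ∈ n.vertices →
      (degCirc c d n' : ℤ) - degCirc c d n = 2 * n.sgn t := by
    intro htn
    rw [← hln.vertices_eq] at htn
    have hSV : S ⊆ l.vertices := by
      refine fun v hv => (hS.1.subset_of_closed (T := S ∩ l.vertices) Set.inter_subset_left
        ⟨t, ht, htn⟩ (fun v hv w hvw => ⟨(hS.1.mem_iff hvw).1 hv.1, ?_⟩) hv).2
      rcases hvw with h | h | h | h
      exacts [(hcc.2.1 _ h).2, (hcc.2.1 _ h).1, (hdc.2.1 _ h).2, (hdc.2.1 _ h).1]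
    obtain ⟨F, rfl⟩ := (l.finite_vertices.subset hSV).exists_finset_coe
    simp only [Finset.mem_coe] at *
    obtain ⟨f, hf, hfc⟩ := hcc.exists_matching hSV hrayc hclc
    obtain ⟨g, hg, hgd⟩ := hdc.exists_matching hSV hrayd hcld
    have h1 := hcc.deg_reverse l.finite_vertices hcn hf hfc hn'
    have h2 := hdc.deg_reverse l.finite_vertices hdn hg hgd hn'
    have h3 := arcSum_add_arcSum hf hg (fun v hv => hcn.sgn_eq_neg (hfc v hv))
      (fun v hv => hdn.sgn_eq_neg (hgd v hv)) ht htmax (fun T hT hTne hTc => ?_)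
    · have h4 : ∀ k, degCirc c d k = c.deg k + d.deg k := fun _ => rfl
      rw [h4, h4]
      push_cast
      omega
    · refine hT.antisymm (Finset.coe_subset.1 (hS.1.subset_of_closed (Finset.coe_subset.2 hT)
        hTne fun v hv w hvw => ?_))
      have hTv := hTc v hv
      have hvf := hfc v (hT hv)
      have hvg := hgd v (hT hv)
      have hw : w = f v ∨ w = g v := by
        rcases hvw with h | h | h | h
        · exact Or.inl (hcc.eq_of_joined (Or.inl h) hvf)
        · exact Or.inl (hcc.eq_of_joined (Or.inr h) hvf)
        · exact Or.inr (hdc.eq_of_joined (Or.inl h) hvg)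
        · exact Or.inr (hdc.eq_of_joined (Or.inr h) hvg)
      rcases hw with rfl | rfl
      exacts [hTv.1, hTv.2]
  refine ⟨hcn.reverse hrayc hclc hn', hdn.reverse hrayd hcld hn', fun h => ?_, fun h => ?_⟩
  · have := main (Or.inl h)
    simp only [Weight.sgn, h, if_true] at this
    omega
  · have := main (Or.inr h)
    simp only [Weight.sgn, h, reduceCtorEq, if_false] at this
    omega

end BK
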